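/- Let g(x) = (x+1)·log(x+1) − x·log x for x > 0, with g(0) = 0 (natural logarithm), and let E ≥ 1/2. Then for all real a, b > 0 with a + b ≤ 2E and a·b ≥ 1/4, one has g(√(a·b) − 1/2) ≤ g(E − 1/2), and equality holds for a = b = E. Consequently, the supremum of g(√(a·b) − 1/2) over such a, b equals g(E − 1/2). (This computes the energy-constrained entanglement-assisted capacity of the exact position measurement: C_ea(M_ex, H, E) = g(E − 1/2).) -/

import Mathlib

/-- `g(x) = (x+1)·log(x+1) − x·log x` (natural logarithm); since `Real.log 0 = 0`
in Mathlib, this formula also gives `g(0) = 0`. -/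
noncomputable def g (x : ℝ) : ℝ := (x + 1) * Real.log (x + 1) - x * Real.log x

theorem hasDerivAt_g {x : ℝ} (hx : 0 < x) :
    HasDerivAt g (Real.log (x + 1) - Real.log x) x := by
  have h₁ := (Real.hasDerivAt_mul_log (x := x + 1) (by positivity)).comp_add_const x 1
  exact (h₁.sub (Real.hasDerivAt_mul_log hx.ne')).congr_deriv (by ring)

theorem continuous_g : Continuous g :=
  (Real.continuous_mul_log.comp (continuous_id.add continuous_const)).sub
    Real.continuous_mul_log

theorem monotoneOn_g : MonotoneOn g (Set.Ici 0) := by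
  refine monotoneOn_of_deriv_nonneg (convex_Ici 0) continuous_g.continuousOn ?_ ?_ <;>
    rw [interior_Ici] <;> intro x hx
  · exact (hasDerivAt_g hx).differentiableAt.differentiableWithinAt
  · rw [(hasDerivAt_g hx).deriv, sub_nonneg]
    exact Real.log_le_log hx (by linarith)

/-- The energy-constrained entanglement-assisted capacity of the exact position
measurement of one bosonic mode with oscillator Hamiltonian and energy level
`E ≥ 1/2` equals `g(E − 1/2)`: the maximum of `g(√(a·b) − 1/2)` over `a, b > 0`
with `a + b ≤ 2E`, `a·b ≥ 1/4` is attained at `a = b = E`. -/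
theorem capacity_exact_position (E : ℝ) (hE : 1/2 ≤ E) :
    (∀ a b : ℝ, 0 < a → 0 < b → a + b ≤ 2 * E → 1/4 ≤ a * b →
        g (Real.sqrt (a * b) - 1/2) ≤ g (E - 1/2)) ∧
    g (Real.sqrt (E * E) - 1/2) = g (E - 1/2) ∧
    IsGreatest {y : ℝ | ∃ a b : ℝ, 0 < a ∧ 0 < b ∧ a + b ≤ 2 * E ∧ 1/4 ≤ a * b ∧
        y = g (Real.sqrt (a * b) - 1/2)} (g (E - 1/2)) := by
  have bound : ∀ a b : ℝ, 0 < a → 0 < b → a + b ≤ 2 * E → 1/4 ≤ a * b →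
      g (Real.sqrt (a * b) - 1/2) ≤ g (E - 1/2) := by
    intro a b ha hb hab h
    have hlo : 1/2 ≤ Real.sqrt (a * b) := Real.le_sqrt_of_sq_le (by linarith)
    have hhi : Real.sqrt (a * b) ≤ E :=
      Real.sqrt_le_iff.mpr ⟨by linarith, by nlinarith [sq_nonneg (a - b)]⟩
    exact monotoneOn_g (Set.mem_Ici.mpr (by linarith)) (Set.mem_Ici.mpr (by linarith))
      (by linarith)
  have attained : g (Real.sqrt (E * E) - 1/2) = g (E - 1/2) := by
    rw [Real.sqrt_mul_self (by linarith)]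
  refine ⟨bound, attained,
    ⟨E, E, by linarith, by linarith, by linarith, by nlinarith, attained.symm⟩, ?_⟩
  rintro y ⟨a, b, ha, hb, hab, h, rfl⟩
  exact bound a b ha hb hab h
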